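/- The high-peak-tent function γ(t) := (2/π)·ln|coth(πt/2)| is a probability density on ℝ whose Fourier transform satisfies ∫_ℝ γ(t)·e^{−iωt} dt = tanh(ω/2)/(ω/2) for all real ω ≠ 0. -/

import Mathlib

open MeasureTheory

/-- The high-peak-tent function γ(t) = (2/π)·ln|coth(πt/2)|. -/
noncomputable def gammaDen (t : ℝ) : ℝ :=
  (2 / Real.pi) * Real.log |Real.cosh (Real.pi * t / 2) / Real.sinh (Real.pi * t / 2)|

theorem aux_S (w : ℝ) (hw : w ≠ 0) :
    HasSum (fun n : ℕ => 1 / (w ^ 2 + (((n : ℝ) + 1) * Real.pi) ^ 2))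
      ((Real.cosh w / Real.sinh w - 1 / w) / (2 * w)) := by
  have hpi : (Real.pi : ℂ) ≠ 0 := by exact_mod_cast Real.pi_ne_zero
  have hwc : (w : ℂ) ≠ 0 := by exact_mod_cast hw
  set x : ℂ := Complex.I * w / Real.pi with hx
  have him : x.im = w / Real.pi := by
    have : x = Complex.I * ((w / Real.pi : ℝ) : ℂ) := by rw [hx]; push_cast; ring
    rw [this]; simp
  have hz : x ∈ Complex.integerComplement := by
    rw [Complex.mem_integerComplement_iff]
    rintro ⟨n, hn⟩
    have h1 := congrArg Complex.im hn
    rw [him] at h1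
    have h5 : w / Real.pi = 0 := by simpa using h1.symm
    exact div_ne_zero hw Real.pi_ne_zero h5
  have h1 := (summable_cotTerm hz).hasSum
  have h2 := cot_series_rep' hz
  have h3 : (∑' n, cotTerm x n) = Real.pi * Complex.cot (Real.pi * x) - 1 / x := h2.symm
  rw [h3] at h1
  have h4 := h1.mul_right (Complex.I / (2 * w * Real.pi))
  have hs : Real.sinh w ≠ 0 := by simpa using hw
  have hsc : Complex.sinh (w : ℂ) ≠ 0 := by
    rw [← Complex.ofReal_sinh]; exact_mod_cast hs
  rw [← Complex.hasSum_ofReal]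
  convert! h4 using 1
  · funext n
    rw [cotTerm_identity hz n]
    have hpos : 0 < w ^ 2 + (((n : ℝ) + 1) * Real.pi) ^ 2 := by positivity
    have hposc : (w : ℂ) ^ 2 + (((n : ℂ) + 1) * Real.pi) ^ 2 ≠ 0 := by
      exact_mod_cast hpos.ne'
    have e : (x + (n + 1)) * (x - (n + 1))
        = -((w : ℂ) ^ 2 + (((n : ℂ) + 1) * Real.pi) ^ 2) / Real.pi ^ 2 := by
      rw [hx]
      field_simp
      ring_nf
      simp only [Complex.I_sq]
      ring
    rw [e, hx]
    push_cast
    rw [one_div, one_div, inv_div]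
    field_simp
    simp only [Complex.I_sq]
    ring
  · have e : (Real.pi : ℂ) * x = w * Complex.I := by rw [hx]; field_simp
    rw [e, Complex.cot, Complex.cos_mul_I, Complex.sin_mul_I, hx]
    push_cast
    field_simp

theorem aux_odd (w a b : ℝ)
    (hA : HasSum (fun n : ℕ => 1 / (w ^ 2 + (((n : ℝ) + 1) * Real.pi) ^ 2)) a)
    (hB : HasSum (fun n : ℕ => 1 / ((w / 2) ^ 2 + (((n : ℝ) + 1) * Real.pi) ^ 2)) b) :
    HasSum (fun k : ℕ => 1 / (w ^ 2 + ((2 * (k : ℝ) + 1) * Real.pi) ^ 2)) (a - b / 4) := by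
  set f : ℕ → ℝ := fun n : ℕ => 1 / (w ^ 2 + (((n : ℝ) + 1) * Real.pi) ^ 2) with hf
  have hodd : HasSum (fun k => f (2 * k + 1)) (b / 4) := by
    convert! hB.div_const 4 using 1
    funext k
    simp only [hf]
    rw [div_div]
    push_cast
    congr 1
    ring
  have hev : Summable (fun k => f (2 * k)) :=
    hA.summable.comp_injective (fun a b h => by simpa using h)
  have h := HasSum.even_add_odd hev.hasSum hodd
  have := h.unique hA
  have e : (∑' k, f (2 * k)) = a - b / 4 := by linarith
  have h5 := hev.hasSum
  rw [e] at h5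
  convert! h5 using 1
  funext k
  simp [hf]

theorem aux_tanh (w : ℝ) (hw : w ≠ 0) :
    HasSum (fun k : ℕ => 8 / (w ^ 2 + ((2 * (k : ℝ) + 1) * Real.pi) ^ 2))
      (Real.tanh (w / 2) / (w / 2)) := by
  have h := (aux_odd w _ _ (aux_S w hw) (aux_S (w / 2) (by positivity))).mul_left 8
  convert! h using 1
  · funext k; ring
  · have hs : Real.sinh (w / 2) ≠ 0 := by
      simpa using hw
    have hc : Real.cosh (w / 2) ≠ 0 := (Real.cosh_pos _).ne'
    have e1 : Real.sinh w = 2 * Real.sinh (w / 2) * Real.cosh (w / 2) := by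
      rw [← Real.sinh_two_mul]; congr 1; ring
    have e2 : Real.cosh w = Real.cosh (w / 2) ^ 2 + Real.sinh (w / 2) ^ 2 := by
      rw [← Real.cosh_two_mul]; congr 1; ring
    rw [e1, e2, Real.tanh_eq_sinh_div_cosh]
    field_simp
    ring

theorem aux_zero :
    HasSum (fun k : ℕ => 8 / ((0 : ℝ) ^ 2 + ((2 * (k : ℝ) + 1) * Real.pi) ^ 2)) 1 := by
  have h0 : HasSum (fun n : ℕ => 1 / ((0 : ℝ) ^ 2 + (((n : ℝ) + 1) * Real.pi) ^ 2)) (1 / 6) := by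
    have h := ((hasSum_nat_add_iff' 1).mpr hasSum_zeta_two).mul_left (1 / Real.pi ^ 2)
    convert! h using 1
    · funext n
      push_cast
      field_simp
      simp
    · simp
      field_simp
  have h := (aux_odd 0 _ _ h0 (by simpa using h0)).mul_left 8
  convert! h using 1
  · funext k; ring
  · norm_num

theorem aux_int (a w : ℝ) (ha : 0 < a) :
    Integrable (fun t : ℝ => ((Real.exp (-(a * |t|)) : ℝ) : ℂ) *
      Complex.exp (-(Complex.I * w * t))) ∧
    ∫ t : ℝ, ((Real.exp (-(a * |t|)) : ℝ) : ℂ) * Complex.exp (-(Complex.I * w * t))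
      = ((2 * a / (w ^ 2 + a ^ 2) : ℝ) : ℂ) := by
  set f : ℝ → ℂ := fun t : ℝ => ((Real.exp (-(a * |t|)) : ℝ) : ℂ) *
      Complex.exp (-(Complex.I * w * t)) with hf
  have e1 : Set.EqOn (fun t : ℝ => Complex.exp ((a - Complex.I * w) * t)) f (Set.Iic 0) := by
    intro t ht
    simp only [hf]
    rw [abs_of_nonpos ht, Complex.ofReal_exp, ← Complex.exp_add]
    congr 1
    push_cast
    ring
  have e2 : Set.EqOn (fun t : ℝ => Complex.exp ((-a - Complex.I * w) * t)) f (Set.Ioi 0) := by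
    intro t ht
    simp only [hf]
    rw [abs_of_pos ht, Complex.ofReal_exp, ← Complex.exp_add]
    congr 1
    push_cast
    ring
  have r1 : 0 < ((a : ℂ) - Complex.I * w).re := by simpa using ha
  have r2 : (-(a : ℂ) - Complex.I * w).re < 0 := by simpa using ha
  have i1 := (integrableOn_exp_mul_complex_Iic r1 0).congr_fun e1 measurableSet_Iic
  have i2 := (integrableOn_exp_mul_complex_Ioi r2 0).congr_fun e2 measurableSet_Ioi
  refine ⟨?_, ?_⟩
  · rw [← integrableOn_univ, ← Set.Iic_union_Ioi (a := (0 : ℝ))]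
    exact i1.union i2
  · rw [← intervalIntegral.integral_Iic_add_Ioi i1 i2,
      ← setIntegral_congr_fun measurableSet_Iic e1,
      ← setIntegral_congr_fun measurableSet_Ioi e2,
      integral_exp_mul_complex_Iic r1, integral_exp_mul_complex_Ioi r2]
    have n1 : (a : ℂ) - Complex.I * w ≠ 0 := by
      intro h; rw [h] at r1; simp at r1
    have n2 : -(a : ℂ) - Complex.I * w ≠ 0 := by
      intro h; rw [h] at r2; simp at r2
    have n3 : (w : ℂ) ^ 2 + (a : ℂ) ^ 2 ≠ 0 := by
      have : 0 < w ^ 2 + a ^ 2 := by positivity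
      exact_mod_cast this.ne'
    push_cast
    simp only [mul_zero, Complex.exp_zero]
    rw [div_add_div _ _ n1 n2, div_eq_div_iff (mul_ne_zero n1 n2) n3]
    ring_nf
    simp only [Complex.I_sq]
    ring

theorem aux_series (t : ℝ) (ht : t ≠ 0) :
    HasSum (fun k : ℕ => 4 / ((2 * (k : ℝ) + 1) * Real.pi) *
      Real.exp (-((2 * (k : ℝ) + 1) * Real.pi * |t|))) (gammaDen t) := by
  have hp := Real.pi_pos
  have htp : 0 < |t| := abs_pos.mpr ht
  set q := Real.exp (-(Real.pi * |t|)) with hq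
  have q0 : 0 < q := Real.exp_pos _
  have q1 : q < 1 := by
    rw [hq, Real.exp_lt_one_iff]
    have := mul_pos hp htp
    linarith
  have h := (Real.hasSum_log_sub_log_of_abs_lt_one (x := q)
    (by rw [abs_of_pos q0]; exact q1)).mul_left (2 / Real.pi)
  convert! h using 1
  · funext k
    have : Real.exp (-((2 * (k : ℝ) + 1) * Real.pi * |t|)) = q ^ (2 * k + 1) := by
      rw [hq, ← Real.exp_nat_mul]
      congr 1
      push_cast
      ring
    rw [this]
    field_simp
    ring
  · unfold gammaDen
    congr 1
    rw [← Real.log_div (by linarith) (by linarith)]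
    congr 1
    have hab : |Real.cosh (Real.pi * t / 2) / Real.sinh (Real.pi * t / 2)|
        = Real.cosh (Real.pi * |t| / 2) / Real.sinh (Real.pi * |t| / 2) := by
      have e : Real.pi * |t| / 2 = |Real.pi * t / 2| := by
        rw [abs_div, abs_mul, abs_of_pos hp]; simp
      rw [e, abs_div, Real.cosh_abs, ← Real.abs_sinh, abs_of_pos (Real.cosh_pos _)]
    rw [hab, Real.cosh_eq, Real.sinh_eq]
    set E := Real.exp (Real.pi * |t| / 2) with hE
    have hE0 : 0 < E := Real.exp_pos _
    have hE1 : 1 < E := Real.one_lt_exp_iff.mpr (by positivity)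
    have e1 : Real.exp (-(Real.pi * |t| / 2)) = 1 / E := by rw [Real.exp_neg, one_div]
    have e2 : q = 1 / E ^ 2 := by
      rw [hq, hE, ← Real.exp_nat_mul, one_div, ← Real.exp_neg]
      congr 1
      push_cast
      ring
    rw [e1, e2]
    have : E ^ 2 - 1 ≠ 0 := by nlinarith
    field_simp

theorem aux_main (w : ℝ) :
    HasSum (fun k : ℕ => ((8 / (w ^ 2 + ((2 * (k : ℝ) + 1) * Real.pi) ^ 2) : ℝ) : ℂ))
      (∫ t : ℝ, (gammaDen t : ℂ) * Complex.exp (-(Complex.I * w * t))) := by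
  have hp := Real.pi_pos
  set F : ℕ → ℝ → ℂ := fun k t => ((4 / ((2 * (k : ℝ) + 1) * Real.pi) : ℝ) : ℂ) *
    (((Real.exp (-((2 * (k : ℝ) + 1) * Real.pi * |t|)) : ℝ) : ℂ) *
      Complex.exp (-(Complex.I * w * t))) with hF
  have hpos : ∀ k : ℕ, 0 < (2 * (k : ℝ) + 1) * Real.pi := fun k => by positivity
  have hint : ∀ k, Integrable (F k) := fun k => ((aux_int _ w (hpos k)).1).const_mul _
  have hnorm : ∀ k, ∫ t, ‖F k t‖ = 8 / ((0 : ℝ) ^ 2 + ((2 * (k : ℝ) + 1) * Real.pi) ^ 2) := by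
    intro k
    have h1 : ∀ t : ℝ, ‖F k t‖ = 4 / ((2 * (k : ℝ) + 1) * Real.pi) *
        Real.exp (-((2 * (k : ℝ) + 1) * Real.pi * |t|)) := by
      intro t
      simp only [hF]
      rw [norm_mul, norm_mul, Complex.norm_real, Complex.norm_real, Complex.norm_exp,
        Real.norm_of_nonneg (div_pos (by norm_num) (hpos k)).le,
        Real.norm_of_nonneg (Real.exp_pos _).le]
      simp
    simp_rw [h1]
    rw [integral_const_mul]
    have h2 := (aux_int _ 0 (hpos k)).2
    simp only [Complex.ofReal_zero, mul_zero, zero_mul, neg_zero, Complex.exp_zero, mul_one] at h2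
    rw [integral_complex_ofReal] at h2
    rw [Complex.ofReal_injective h2]
    have := hpos k
    field_simp
    ring
  have hsum : Summable fun k => ∫ t, ‖F k t‖ := by
    simp_rw [hnorm]; exact aux_zero.summable
  have h := hasSum_integral_of_summable_integral_norm hint hsum
  convert! h using 1
  · funext k
    simp only [hF]
    rw [integral_const_mul, (aux_int _ w (hpos k)).2, ← Complex.ofReal_mul]
    congr 1
    have := hpos k
    field_simp
    ring
  · apply integral_congr_ae
    have : ∀ᵐ t : ℝ, t ≠ 0 := by simp [ae_iff]
    filter_upwards [this] with t ht
    have h3 := (Complex.hasSum_ofReal.mpr (aux_series t ht)).mul_right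
      (Complex.exp (-(Complex.I * w * t)))
    rw [← h3.tsum_eq]
    congr 1
    funext k
    simp only [hF]
    push_cast
    ring

/-- γ is a probability density whose Fourier transform is tanh(ω/2)/(ω/2). -/
theorem gammaDen_density_and_fourier :
    (∀ t : ℝ, t ≠ 0 → 0 ≤ gammaDen t) ∧
    (∫ t : ℝ, gammaDen t) = 1 ∧
    (∀ ω : ℝ, ω ≠ 0 →
      (∫ t : ℝ, (gammaDen t : ℂ) * Complex.exp (-(Complex.I * ω * t))) =
        ((Real.tanh (ω / 2) / (ω / 2) : ℝ) : ℂ)) := by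
  refine ⟨?_, ?_, ?_⟩
  · intro t ht
    have hp := Real.pi_pos
    exact (aux_series t ht).nonneg (fun k => by positivity)
  · have h := (aux_main 0).unique (Complex.hasSum_ofReal.mpr aux_zero)
    simp only [Complex.ofReal_zero, mul_zero, zero_mul, neg_zero, Complex.exp_zero, mul_one] at h
    rw [integral_complex_ofReal] at h
    exact Complex.ofReal_injective h
  · intro w hw
    exact (aux_main w).unique (Complex.hasSum_ofReal.mpr (aux_tanh w hw))
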